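/- Let 𝒮 and 𝒴 be finite types, let Δ(𝒮) denote the standard probability simplex in ℝ^𝒮, and for each y ∈ 𝒴 let M(y) ∈ ℝ^{𝒮×𝒮} be a matrix with nonnegative entries such that for every y and every ξ ∈ Δ(𝒮) the scalar σ(ξ, y) := Σ_{s′ ∈ 𝒮} Σ_{s ∈ 𝒮} M(y)_{s′,s} · ξ(s) is strictly positive, and such that for every s ∈ 𝒮, Σ_{y ∈ 𝒴} Σ_{s′ ∈ 𝒮} M(y)_{s′,s} = 1. For ξ ∈ Δ(𝒮) and y ∈ 𝒴 define T(ξ, y) ∈ Δ(𝒮) by T(ξ, y)(s′) = (Σ_{s ∈ 𝒮} M(y)_{s′,s} · ξ(s)) / σ(ξ, y). Then for every concave function V : ℝ^𝒮 → ℝ on Δ(𝒮), the function ξ ↦ Σ_{y ∈ 𝒴} σ(ξ, y) · V(T(ξ, y)) is concave on Δ(𝒮). -/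

import Mathlib

/-- The perspective of a concave function on the standard simplex is concave on the cone of
nonnegative vectors with positive total mass. -/
theorem ConcaveOn.perspective_stdSimplex {ι : Type*} [Fintype ι] {V : (ι → ℝ) → ℝ}
    (hV : ConcaveOn ℝ (stdSimplex ℝ ι) V) :
    ConcaveOn ℝ {x : ι → ℝ | (∀ i, 0 ≤ x i) ∧ 0 < ∑ i, x i}
      (fun x => (∑ i, x i) * V (fun i => x i / ∑ j, x j)) := by
  have sum_comb (x y : ι → ℝ) (a b : ℝ) :
      ∑ i, (a • x + b • y) i = a * ∑ i, x i + b * ∑ i, y i := by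
    simp [Finset.sum_add_distrib, Finset.mul_sum]
  have sum_pos {x y : ι → ℝ} {a b : ℝ} (hx : 0 < ∑ i, x i) (hy : 0 < ∑ i, y i)
      (ha : 0 ≤ a) (hb : 0 ≤ b) (hab : a + b = 1) : 0 < a * ∑ i, x i + b * ∑ i, y i :=
    convex_Ioi (0 : ℝ) hx hy ha hb hab
  have normalize_mem {x : ι → ℝ} (hx : (∀ i, 0 ≤ x i) ∧ 0 < ∑ i, x i) :
      (fun i => x i / ∑ j, x j) ∈ stdSimplex ℝ ι :=
    ⟨fun i => div_nonneg (hx.1 i) hx.2.le, by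
      rw [← Finset.sum_div, div_self hx.2.ne']⟩
  refine ⟨fun x hx y hy a b ha hb hab => ⟨fun i => ?_, ?_⟩,
    fun x hx y hy a b ha hb hab => ?_⟩
  · exact add_nonneg (mul_nonneg ha (hx.1 i)) (mul_nonneg hb (hy.1 i))
  · rw [sum_comb]
    exact sum_pos hx.2 hy.2 ha hb hab
  · have hz := sum_pos hx.2 hy.2 ha hb hab
    have hVx := normalize_mem hx
    have hVy := normalize_mem hy
    have hx' := hx.2
    have hy' := hy.2
    simp only [sum_comb]
    set p := ∑ i, x i
    set q := ∑ i, y i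
    set r := a * p + b * q with hr
    have key := hV.2 hVx hVy (show 0 ≤ a * p / r by positivity)
      (show 0 ≤ b * q / r by positivity)
      (by rw [← add_div, ← hr, div_self hz.ne'])
    have hcomb : (a * p / r) • (fun i => x i / p) + (b * q / r) • (fun i => y i / q) =
        fun i => (a • x + b • y) i / r := by
      ext i
      simp only [Pi.add_apply, Pi.smul_apply, smul_eq_mul]
      field_simp
    rw [hcomb] at key
    have hmul := mul_le_mul_of_nonneg_left key hz.le
    refine le_trans (le_of_eq ?_) hmul
    simp only [smul_eq_mul]
    field_simp


/-- Concavity-propagation step underlying Theorem 2: the expected continuation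
value `ξ ↦ Σ_y σ(ξ, y) · V(T(ξ, y))` of the Bayesian-filter belief update
preserves concavity of the value function `V` on the probability simplex. -/
theorem expected_continuation_value_concave
    (𝒮 𝒴 : Type*) [Fintype 𝒮] [Fintype 𝒴]
    (M : 𝒴 → Matrix 𝒮 𝒮 ℝ)
    (hnn : ∀ (y : 𝒴) (s' s : 𝒮), 0 ≤ M y s' s)
    (hpos : ∀ (y : 𝒴), ∀ ξ ∈ stdSimplex ℝ 𝒮, 0 < ∑ s' : 𝒮, ∑ s : 𝒮, M y s' s * ξ s)
    (hsum : ∀ s : 𝒮, ∑ y : 𝒴, ∑ s' : 𝒮, M y s' s = 1)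
    (V : (𝒮 → ℝ) → ℝ) (hV : ConcaveOn ℝ (stdSimplex ℝ 𝒮) V) :
    ConcaveOn ℝ (stdSimplex ℝ 𝒮)
      (fun ξ => ∑ y : 𝒴, (∑ s' : 𝒮, ∑ s : 𝒮, M y s' s * ξ s)
        * V (fun s' => (∑ s : 𝒮, M y s' s * ξ s)
            / ∑ stil : 𝒮, ∑ s : 𝒮, M y stil s * ξ s)) := by
  have hterm (y : 𝒴) : ConcaveOn ℝ (stdSimplex ℝ 𝒮)
      (fun ξ => (∑ s' : 𝒮, ∑ s : 𝒮, M y s' s * ξ s)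
        * V (fun s' => (∑ s : 𝒮, M y s' s * ξ s)
            / ∑ stil : 𝒮, ∑ s : 𝒮, M y stil s * ξ s)) :=
    (hV.perspective_stdSimplex.comp_linearMap (M y).mulVecLin).subset
      (fun ξ hξ => ⟨fun s' => Finset.sum_nonneg fun s _ => mul_nonneg (hnn y s' s) (hξ.1 s),
        hpos y ξ hξ⟩)
      (convex_stdSimplex ℝ 𝒮)
  refine ⟨convex_stdSimplex ℝ 𝒮, fun ξ hξ η hη a b ha hb hab => ?_⟩
  simp only [Finset.smul_sum, ← Finset.sum_add_distrib]
  exact Finset.sum_le_sum fun y _ => (hterm y).2 hξ hη ha hb hab
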